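/- Let A = KQ/I be a finite-dimensional algebra over an algebraically closed field K, where Q is a finite quiver and I is an admissible ideal of KQ. If A is geometrically irreducible, then every cycle in Q is a power of a loop, i.e. for every cycle (a_1,…,a_m) in Q there is a loop ε with a_1 = a_2 = ⋯ = a_m = ε. -/

import Mathlib

open scoped BigOperators

noncomputable section
/-! ## Quivers and paths -/

/-- A finite quiver: finite sets of vertices and arrows together with source and
target maps. -/
structure FinQuiver : Type 1 where
  V : Type
  A : Type
  [fintypeV : Fintype V]
  [fintypeA : Fintype A]
  [decEqV : DecidableEq V]
  [decEqA : DecidableEq A]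
  src : A → V
  tgt : A → V

attribute [instance] FinQuiver.fintypeV FinQuiver.fintypeA FinQuiver.decEqV FinQuiver.decEqA

/-- A path of positive length in a quiver: a list of composable arrows `[a₁, …, aₘ]`
satisfying `s (aᵢ) = t (aᵢ₊₁)`. -/
structure QPath (Q : FinQuiver) : Type where
  arrows : List Q.A
  ne : arrows ≠ []
  chain : arrows.Chain' fun a b => Q.src a = Q.tgt b

namespace QPath

variable {Q : FinQuiver}

/-- The length of a path. -/
def length (p : QPath Q) : ℕ := p.arrows.length

/-- The target `t (a₁)` of a path `(a₁, …, aₘ)`. -/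
def tgt (p : QPath Q) : Q.V := Q.tgt (p.arrows.head p.ne)

/-- The source `s (aₘ)` of a path `(a₁, …, aₘ)`. -/
def src (p : QPath Q) : Q.V := Q.src (p.arrows.getLast p.ne)

/-- A path is a cycle if its source equals its target. -/
def IsCycle (p : QPath Q) : Prop := p.src = p.tgt

/-- A cycle `(a₁, …, aₘ)` is primitive if the vertices `s (a₁), …, s (aₘ)` are pairwise
different. -/
def IsPrimitive (p : QPath Q) : Prop := (p.arrows.map Q.src).Nodup

end QPath

/-! ## The path algebra, relations, admissible ideals and representation varieties -/

/-- The defining relations presenting the path algebra `KQ` as a quotient of the free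
algebra on the vertices and arrows of `Q`: the vertices become a complete set of
orthogonal idempotents summing to `1`, and `e_{t(a)} * a = a = a * e_{s(a)}` for every
arrow `a`. -/
inductive PathRel (K : Type) [Field K] (Q : FinQuiver) :
    FreeAlgebra K (Q.V ⊕ Q.A) → FreeAlgebra K (Q.V ⊕ Q.A) → Prop
  | idem (i : Q.V) : PathRel K Q
      (FreeAlgebra.ι K (Sum.inl i) * FreeAlgebra.ι K (Sum.inl i)) (FreeAlgebra.ι K (Sum.inl i))
  | orth (i j : Q.V) (h : i ≠ j) : PathRel K Q
      (FreeAlgebra.ι K (Sum.inl i) * FreeAlgebra.ι K (Sum.inl j)) 0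
  | sum_one : PathRel K Q (∑ i : Q.V, FreeAlgebra.ι K (Sum.inl i)) 1
  | tgt_mul (a : Q.A) : PathRel K Q
      (FreeAlgebra.ι K (Sum.inl (Q.tgt a)) * FreeAlgebra.ι K (Sum.inr a))
      (FreeAlgebra.ι K (Sum.inr a))
  | mul_src (a : Q.A) : PathRel K Q
      (FreeAlgebra.ι K (Sum.inr a) * FreeAlgebra.ι K (Sum.inl (Q.src a)))
      (FreeAlgebra.ι K (Sum.inr a))

/-- The path algebra `KQ`. -/
abbrev PathAlgebra (K : Type) [Field K] (Q : FinQuiver) : Type := RingQuot (PathRel K Q)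

variable (K : Type) [Field K] (Q : FinQuiver)

/-- The idempotent `eᵢ ∈ KQ` corresponding to a vertex `i` (the path of length zero
at `i`). -/
def vertexElem (i : Q.V) : PathAlgebra K Q :=
  RingQuot.mkAlgHom K (PathRel K Q) (FreeAlgebra.ι K (Sum.inl i))

/-- The element of `KQ` corresponding to an arrow `a`. -/
def arrowElem (a : Q.A) : PathAlgebra K Q :=
  RingQuot.mkAlgHom K (PathRel K Q) (FreeAlgebra.ι K (Sum.inr a))

/-- The element of `KQ` corresponding to a path `(a₁, …, aₘ)`, namely `a₁ ⋯ aₘ`. -/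
def pathElem (p : QPath Q) : PathAlgebra K Q := (p.arrows.map (arrowElem K Q)).prod

/-- The element `∑ₚ c p • p` of `KQ` determined by a finitely supported family of
coefficients on paths. -/
def relElem (c : QPath Q →₀ K) : PathAlgebra K Q := c.sum fun p l => l • pathElem K Q p

/-- `c` is the datum of a relation with common target `i` and common source `j`: all
paths in its support have length at least two, target `i` and source `j`.  (The paths in
the support are pairwise different and have nonzero coefficients by definition of a
finitely supported function.) -/
def IsRelationData (c : QPath Q →₀ K) (i j : Q.V) : Prop :=
  ∀ p ∈ c.support, 2 ≤ p.length ∧ p.tgt = i ∧ p.src = j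

/-- An element of `KQ` is a relation if it is a `K`-linear combination `∑ λₚ • p` of
pairwise different paths of length at least two having a common source and a common
target, with all `λₚ ≠ 0`. -/
def IsRelation (x : PathAlgebra K Q) : Prop :=
  ∃ (c : QPath Q →₀ K) (i j : Q.V), IsRelationData K Q c i j ∧ x = relElem K Q c

/-- The two-sided ideal generated by a set `S`, as a set: the additive subgroup generated
by all elements `a * s * b` with `s ∈ S`. -/
def twoSidedSpan (R : Type) [Ring R] (S : Set R) : Set R :=
  (AddSubgroup.closure {x | ∃ a b : R, ∃ s ∈ S, x = a * s * b} : AddSubgroup R)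

/-- `φ : KQ →ₐ[K] A` presents `A` as `KQ/I` with `I = ker φ` an admissible ideal:
`φ` is surjective, its kernel is generated (as a two-sided ideal) by a set of relations,
and there is some `m ≥ 2` such that all paths of length at least `m` lie in the kernel. -/
def IsAdmissiblePresentation {A : Type} [Ring A] [Algebra K A]
    (φ : PathAlgebra K Q →ₐ[K] A) : Prop :=
  Function.Surjective φ ∧
  (∃ S : Set (PathAlgebra K Q), (∀ x ∈ S, IsRelation K Q x) ∧
    twoSidedSpan (PathAlgebra K Q) S = {x | φ x = 0}) ∧
  ∃ m : ℕ, 2 ≤ m ∧ ∀ p : QPath Q, m ≤ p.length → φ (pathElem K Q p) = 0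

/-- The index type for the rows/columns of the matrices in a `d`-dimensional
representation: the basis vectors of `⊕ᵢ K^{dᵢ}`. -/
abbrev RepIx (d : Q.V → ℕ) : Type := (i : Q.V) × Fin (d i)

/-- The ambient affine space of `d`-dimensional representations.  An arrow `a` gets a
matrix; membership in `RepSet` forces the matrix of `a` to be concentrated in the block
with rows indexed by the block `t(a)` and columns indexed by the block `s(a)`, i.e. to be
(the block extension of) a `d (t a) × d (s a)`-matrix. -/
abbrev RepSpace (d : Q.V → ℕ) : Type := Q.A → Matrix (RepIx Q d) (RepIx Q d) K

/-- The Zariski topology on affine space `K^ι`: generated by the complements of zero sets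
of polynomials in the coordinates. -/
def zariskiTopology (ι R : Type) [CommSemiring R] : TopologicalSpace (ι → R) :=
  TopologicalSpace.generateFrom
    {U | ∃ f : MvPolynomial ι R, U = {x | MvPolynomial.eval x f ≠ 0}}

/-- The Zariski topology on the ambient space of `d`-dimensional representations. -/
def repTopology (d : Q.V → ℕ) : TopologicalSpace (RepSpace K Q d) :=
  TopologicalSpace.induced (fun M (x : Q.A × RepIx Q d × RepIx Q d) => M x.1 x.2.1 x.2.2)
    (zariskiTopology (Q.A × RepIx Q d × RepIx Q d) K)

/-- The condition that the matrix of each arrow `a` is concentrated in the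
`(t a, s a)`-block, i.e. really is a `d (t a) × d (s a)`-matrix. -/
def BlockCompatible (d : Q.V → ℕ) (M : RepSpace K Q d) : Prop :=
  ∀ (a : Q.A) (u v : RepIx Q d), M a u v ≠ 0 → u.1 = Q.tgt a ∧ v.1 = Q.src a

/-- The evaluation `M(p) = M(a₁) ⋯ M(aₘ)` of a representation at a path. -/
def pathProd (d : Q.V → ℕ) (M : RepSpace K Q d) (p : QPath Q) :
    Matrix (RepIx Q d) (RepIx Q d) K := (p.arrows.map M).prod

/-- The evaluation `M(ρ) = ∑ λₚ M(p)` of a representation at a linear combination of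
paths. -/
def relEval (d : Q.V → ℕ) (M : RepSpace K Q d) (c : QPath Q →₀ K) :
    Matrix (RepIx Q d) (RepIx Q d) K := c.sum fun p l => l • pathProd K Q d M p

/-- The affine variety `rep(A, d)` of `d`-dimensional representations of `A = KQ/I`,
where `I = ker φ`: tuples of matrices (of the correct block sizes) with `M(ρ) = 0` for
every relation `ρ ∈ I`. -/
def RepSet {A : Type} [Ring A] [Algebra K A] (φ : PathAlgebra K Q →ₐ[K] A) (d : Q.V → ℕ) :
    Set (RepSpace K Q d) :=
  {M | BlockCompatible K Q d M ∧
    ∀ (c : QPath Q →₀ K) (i j : Q.V), IsRelationData K Q c i j →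
      φ (relElem K Q c) = 0 → relEval K Q d M c = 0}

/-- `A = KQ/I` (presented by `φ`, with `I = ker φ`) is geometrically irreducible if
`rep(A, d)` is an irreducible topological space for every dimension vector `d`. -/
def IsGeomIrreducible {A : Type} [Ring A] [Algebra K A] (φ : PathAlgebra K Q →ₐ[K] A) :
    Prop :=
  ∀ d : Q.V → ℕ, @IsIrreducible _ (repTopology K Q d) (RepSet K Q φ d)

/-! ## Factoring homomorphisms through an admissible quotient -/

theorem List.prod_map_eq_zero_of_mul_eq_zero {ι R : Type} [MonoidWithZero R] (x : ι → R)
    (hx : ∀ a b, x a * x b = 0) :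
    ∀ l : List ι, 2 ≤ l.length → (l.map x).prod = 0
  | [], h => by simp at h
  | [_], h => by simp at h
  | a :: b :: l, _ => by simp [← mul_assoc, hx]

section Representations

variable {K Q}

theorem sum_vertexElem : ∑ j, vertexElem K Q j = 1 := by
  simpa [vertexElem] using RingQuot.mkAlgHom_rel K (PathRel.sum_one (K := K) (Q := Q))

theorem vertexElem_tgt_mul (a : Q.A) :
    vertexElem K Q (Q.tgt a) * arrowElem K Q a = arrowElem K Q a := by
  simpa [vertexElem, arrowElem] using RingQuot.mkAlgHom_rel K (PathRel.tgt_mul (K := K) a)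

theorem arrowElem_mul_src (a : Q.A) :
    arrowElem K Q a * vertexElem K Q (Q.src a) = arrowElem K Q a := by
  simpa [vertexElem, arrowElem] using RingQuot.mkAlgHom_rel K (PathRel.mul_src (K := K) a)

theorem map_relElem {C : Type} [Ring C] [Algebra K C] (ψ : PathAlgebra K Q →ₐ[K] C)
    (c : QPath Q →₀ K) :
    ψ (relElem K Q c) =
      c.sum fun p l => l • (p.arrows.map fun a => ψ (arrowElem K Q a)).prod := by
  simp [relElem, Finsupp.sum, pathElem, map_list_prod, Function.comp_def]

theorem IsAdmissiblePresentation.exists_factor {A C : Type} [Ring A] [Algebra K A] [Ring C]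
    [Algebra K C] {φ : PathAlgebra K Q →ₐ[K] A} (hadm : IsAdmissiblePresentation K Q φ)
    (ψ : PathAlgebra K Q →ₐ[K] C)
    (hψ : ∀ (c : QPath Q →₀ K) (i j : Q.V), IsRelationData K Q c i j →
      φ (relElem K Q c) = 0 → ψ (relElem K Q c) = 0) :
    ∃ ρ : A →ₐ[K] C, ∀ x, ρ (φ x) = ψ x := by
  obtain ⟨hsurj, ⟨S, hS, hker⟩, -⟩ := hadm
  have hle : ∀ x, φ x = 0 → ψ x = 0 := by
    intro x hx
    have hx' : x ∈ twoSidedSpan (PathAlgebra K Q) S := by rw [hker]; exact hx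
    refine AddSubgroup.closure_induction (p := fun y _ => ψ y = 0) ?_ (map_zero ψ) ?_ ?_ hx'
    · rintro _ ⟨a, b, s, hs, rfl⟩
      obtain ⟨c, i, j, hc, rfl⟩ := hS s hs
      have : relElem K Q c ∈ twoSidedSpan (PathAlgebra K Q) S :=
        AddSubgroup.subset_closure ⟨1, 1, _, hs, by simp⟩
      rw [hker] at this
      simp [hψ c i j hc this]
    · intro y z _ _ hy hz
      simp [hy, hz]
    · intro y _ hy
      simp [hy]
  let r := (φ : PathAlgebra K Q →+* A).liftOfRightInverse _ (Function.rightInverse_surjInv hsurj)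
    ⟨(ψ : PathAlgebra K Q →+* C), fun x hx => hle x hx⟩
  have hr : ∀ x, r (φ x) = ψ x := fun x =>
    RingHom.liftOfRightInverse_comp_apply (φ : PathAlgebra K Q →+* A) _
      (Function.rightInverse_surjInv hsurj) ⟨(ψ : PathAlgebra K Q →+* C), fun x hx => hle x hx⟩ x
  refine ⟨{ r with commutes' := fun k => ?_ }, hr⟩
  have := hr (algebraMap K _ k)
  rwa [AlgHom.commutes, AlgHom.commutes] at this

/-! ## Representations as algebra homomorphisms -/

/-- The projection onto the block of the vertex `j`. -/
def vertexBlock (R : Type) [CommRing R] (d : Q.V → ℕ) (j : Q.V) :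
    Matrix (RepIx Q d) (RepIx Q d) R :=
  Matrix.diagonal fun u => if u.1 = j then 1 else 0

/-- The evaluation of noncommutative polynomials in the vertices and arrows at a tuple of
matrices. -/
def repEval {R : Type} [CommRing R] [Algebra K R] {d : Q.V → ℕ}
    (M : Q.A → Matrix (RepIx Q d) (RepIx Q d) R) :
    FreeAlgebra K (Q.V ⊕ Q.A) →ₐ[K] Matrix (RepIx Q d) (RepIx Q d) R :=
  FreeAlgebra.lift K (Sum.elim (vertexBlock R d) M)

variable {A : Type} [Ring A] [Algebra K A] {φ : PathAlgebra K Q →ₐ[K] A} {d : Q.V → ℕ}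

theorem BlockCompatible.repEval_rel {M : RepSpace K Q d} (hM : BlockCompatible K Q d M)
    {x y : FreeAlgebra K (Q.V ⊕ Q.A)} (h : PathRel K Q x y) : repEval M x = repEval M y := by
  induction h with
  | idem i => simp [repEval, vertexBlock]
  | orth i j h =>
    simp only [repEval, vertexBlock, map_mul, FreeAlgebra.lift_ι_apply, Sum.elim_inl, map_zero,
      Matrix.diagonal_mul_diagonal, Matrix.diagonal_eq_zero]
    funext u
    by_cases hu : u.1 = i <;> simp [hu, h]
  | sum_one =>
    simp only [repEval, vertexBlock, map_sum, FreeAlgebra.lift_ι_apply, Sum.elim_inl, map_one]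
    ext u v
    rw [Matrix.sum_apply]
    by_cases huv : u = v
    · subst huv; simp
    · simp [huv]
  | tgt_mul a =>
    simp only [repEval, vertexBlock, map_mul, FreeAlgebra.lift_ι_apply, Sum.elim_inl, Sum.elim_inr]
    ext u v
    rw [Matrix.diagonal_mul]
    by_cases h : M a u v = 0
    · simp [h]
    · simp [(hM a u v h).1]
  | mul_src a =>
    simp only [repEval, vertexBlock, map_mul, FreeAlgebra.lift_ι_apply, Sum.elim_inl, Sum.elim_inr]
    ext u v
    rw [Matrix.mul_diagonal]
    by_cases h : M a u v = 0
    · simp [h]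
    · simp [(hM a u v h).2]

theorem exists_algHom_of_mem_repSet (hadm : IsAdmissiblePresentation K Q φ)
    {M : RepSpace K Q d} (hM : M ∈ RepSet K Q φ d) :
    ∃ ρ : A →ₐ[K] Matrix (RepIx Q d) (RepIx Q d) K,
      ∀ t, ρ (φ (RingQuot.mkAlgHom K (PathRel K Q) t)) = repEval M t := by
  let ψ : PathAlgebra K Q →ₐ[K] Matrix (RepIx Q d) (RepIx Q d) K :=
    RingQuot.liftAlgHom K ⟨repEval M, fun _ _ h => hM.1.repEval_rel h⟩
  have hψ : ∀ t, ψ (RingQuot.mkAlgHom K (PathRel K Q) t) = repEval M t := fun t =>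
    RingQuot.liftAlgHom_mkAlgHom_apply K _ _ t
  obtain ⟨ρ, hρ⟩ := hadm.exists_factor ψ fun c i j hc h0 => by
    have := hM.2 c i j hc h0
    rw [map_relElem]
    simpa [arrowElem, hψ, repEval, relEval, pathProd] using this
  exact ⟨ρ, fun t => by rw [hρ, hψ]⟩

theorem exists_mem_repSet_of_algHom
    (ρ : A →ₐ[K] Matrix (RepIx Q d) (RepIx Q d) K)
    (hρ : ∀ j, ρ (φ (vertexElem K Q j)) = vertexBlock K d j) :
    ∃ M ∈ RepSet K Q φ d,
      ∀ t, ρ (φ (RingQuot.mkAlgHom K (PathRel K Q) t)) = repEval M t := by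
  refine ⟨fun a => ρ (φ (arrowElem K Q a)), ⟨?_, ?_⟩, ?_⟩
  · intro a u v h
    constructor
    · by_contra hu
      apply h
      beta_reduce
      rw [← vertexElem_tgt_mul, map_mul, map_mul, hρ, vertexBlock, Matrix.diagonal_mul, if_neg hu, zero_mul]
    · by_contra hu
      apply h
      beta_reduce
      rw [← arrowElem_mul_src, map_mul, map_mul, hρ, vertexBlock, Matrix.mul_diagonal, if_neg hu, mul_zero]
  · intro c i j _ h0
    have := map_relElem (ρ.comp φ) c
    rw [AlgHom.comp_apply, h0, map_zero] at this
    exact this.symm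
  · intro t
    have : (ρ.comp φ).comp (RingQuot.mkAlgHom K (PathRel K Q)) =
        repEval fun a => ρ (φ (arrowElem K Q a)) := by
      ext x : 2
      cases x with
      | inl j => simpa [repEval, vertexElem] using hρ j
      | inr a => simp [repEval, arrowElem]
    exact DFunLike.congr_fun this t

/-! ## Open conditions on representations -/

theorem isOpen_det_ne_zero
    (F : Matrix (RepIx Q d) (RepIx Q d) (MvPolynomial (Q.A × RepIx Q d × RepIx Q d) K)) :
    @IsOpen _ (repTopology K Q d) {M : RepSpace K Q d |
      (F.map (MvPolynomial.eval fun x => M x.1 x.2.1 x.2.2)).det ≠ 0} := by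
  refine ⟨_, TopologicalSpace.GenerateOpen.basic _ ⟨F.det, rfl⟩, ?_⟩
  ext M
  simp only [Set.mem_preimage, Set.mem_ofPred_eq]
  rw [RingHom.map_det]
  rfl

/-- The representation whose matrix entries are independent variables. -/
def genericRep (K : Type) [Field K] {Q : FinQuiver} (d : Q.V → ℕ) (a : Q.A) :
    Matrix (RepIx Q d) (RepIx Q d) (MvPolynomial (Q.A × RepIx Q d × RepIx Q d) K) :=
  Matrix.of fun u v => MvPolynomial.X (a, u, v)

theorem repEval_genericRep_map (M : RepSpace K Q d) (t : FreeAlgebra K (Q.V ⊕ Q.A)) :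
    (repEval (genericRep K d) t).map (MvPolynomial.eval fun x => M x.1 x.2.1 x.2.2) =
      repEval M t := by
  have : ((MvPolynomial.aeval (R := K)
      fun x : Q.A × RepIx Q d × RepIx Q d => M x.1 x.2.1 x.2.2).mapMatrix.comp
      (repEval (genericRep K d))) = repEval M := by
    ext x u v
    cases x with
    | inl j =>
      by_cases huv : u = v
      · subst huv; by_cases hu : u.1 = j <;> simp [repEval, vertexBlock, hu]
      · simp [repEval, vertexBlock, huv]
    | inr a => simp [repEval, genericRep]
  exact DFunLike.congr_fun this t

theorem isOpen_det_mulVec_ne_zero (v : RepIx Q d → K)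
    (t : RepIx Q d → FreeAlgebra K (Q.V ⊕ Q.A)) :
    @IsOpen _ (repTopology K Q d) {M : RepSpace K Q d |
      (Matrix.of fun x y => (repEval M (t y)).mulVec v x).det ≠ 0} := by
  convert isOpen_det_ne_zero
    (Matrix.of fun x y => (repEval (genericRep K d) (t y)).mulVec (MvPolynomial.C ∘ v) x) using 5
  rename_i M
  ext x y
  change (repEval M (t y)).mulVec v x = MvPolynomial.eval _ _
  rw [← repEval_genericRep_map]
  simp [Matrix.mulVec, dotProduct]

theorem isOpen_det_vecMul_ne_zero (f : RepIx Q d → K)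
    (t : RepIx Q d → FreeAlgebra K (Q.V ⊕ Q.A)) :
    @IsOpen _ (repTopology K Q d) {M : RepSpace K Q d |
      (Matrix.of fun x y => Matrix.vecMul f (repEval M (t x)) y).det ≠ 0} := by
  convert isOpen_det_ne_zero
    (Matrix.of fun x y => Matrix.vecMul (MvPolynomial.C ∘ f) (repEval (genericRep K d) (t x)) y)
    using 5
  rename_i M
  ext x y
  change Matrix.vecMul f (repEval M (t x)) y = MvPolynomial.eval _ _
  rw [← repEval_genericRep_map]
  simp [Matrix.vecMul, dotProduct]

/-! ## Generic cyclic and cocyclic representations -/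

theorem exists_mulVec_eq_of_det_ne_zero {X : Type} [Fintype X] [DecidableEq X]
    {P : Matrix X X K} (hP : P.det ≠ 0) (w : X → K) : ∃ c, P.mulVec c = w :=
  ⟨P⁻¹.mulVec w, by
    rw [Matrix.mulVec_mulVec, Matrix.mul_nonsing_inv _ (isUnit_iff_ne_zero.mpr hP),
      Matrix.one_mulVec]⟩

/-- The transposed right regular representation of an algebra with respect to a basis. -/
def rightMulMatrixTranspose {X B : Type} [Fintype X] [DecidableEq X] [Ring B] [Algebra K B]
    (b : Module.Basis X K B) : B →ₐ[K] Matrix X X K :=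
  AlgHom.ofLinearMap
    ((Matrix.transposeLinearEquiv X X K K).toLinearMap ∘ₗ
      (LinearMap.toMatrix b b).toLinearMap ∘ₗ (LinearMap.mul K B).flip)
    (by
      have : (LinearMap.mul K B).flip 1 = LinearMap.id := by ext; simp
      simp [this])
    (by
      intro x y
      have : (LinearMap.mul K B).flip (x * y) =
          (LinearMap.mul K B).flip y ∘ₗ (LinearMap.mul K B).flip x := by
        ext; simp [mul_assoc]
      simp only [LinearMap.comp_apply, LinearEquiv.coe_coe, this]
      rw [LinearMap.toMatrix_comp b b b]
      simp)

theorem vecMul_rightMulMatrixTranspose {X B : Type} [Fintype X] [DecidableEq X] [Ring B]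
    [Algebra K B] (b : Module.Basis X K B) (x y : B) :
    Matrix.vecMul (b.repr x) (rightMulMatrixTranspose b y) = b.repr (x * y) := by
  change Matrix.vecMul _ (LinearMap.toMatrix b b ((LinearMap.mul K B).flip y)).transpose = _
  rw [Matrix.vecMul_transpose, LinearMap.toMatrix_mulVec_repr]
  simp

theorem exists_mem_repSet_of_quotient {B : Type} [Ring B] [Algebra K B] {i : Q.V}
    (q : A →ₐ[K] B) (hi : ∀ j, j ≠ i → q (φ (vertexElem K Q j)) = 0)
    (hd : ∀ u : RepIx Q d, u.1 = i) (σ : B →ₐ[K] Matrix (RepIx Q d) (RepIx Q d) K) :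
    ∃ M ∈ RepSet K Q φ d,
      ∀ t, σ (q (φ (RingQuot.mkAlgHom K (PathRel K Q) t))) = repEval M t := by
  refine exists_mem_repSet_of_algHom (σ.comp q) fun j => ?_
  by_cases hj : j = i
  · subst hj
    have h1 : q (φ (vertexElem K Q j)) = 1 := by
      have := congrArg (fun x => q (φ x)) (sum_vertexElem (K := K) (Q := Q))
      simp only [map_sum, map_one] at this
      rwa [Finset.sum_eq_single j (fun k _ hk => hi k hk) (by simp)] at this
    simp [h1, vertexBlock, hd]
  · have : ∀ u : RepIx Q d, u.1 ≠ j := fun u h => hj (h.symm.trans (hd u))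
    simp [hi j hj, vertexBlock, this]

theorem IsGeomIrreducible.exists_cyclic_cocyclic (hirr : IsGeomIrreducible K Q φ)
    (hadm : IsAdmissiblePresentation K Q φ) (i : Q.V)
    {B : Type} [Ring B] [Algebra K B] [Module.Finite K B] (q : A →ₐ[K] B)
    (hq : Function.Surjective q) (hi : ∀ j, j ≠ i → q (φ (vertexElem K Q j)) = 0) :
    ∃ (X : Type) (_ : Fintype X) (_ : DecidableEq X) (ρ : A →ₐ[K] Matrix X X K) (v f : X → K),
      Fintype.card X = Module.finrank K B ∧
      (∀ j, j ≠ i → ρ (φ (vertexElem K Q j)) = 0) ∧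
      (∀ w, ∃ a, (ρ a).mulVec v = w) ∧ ∀ w, ∃ a, Matrix.vecMul f (ρ a) = w := by
  let d : Q.V → ℕ := fun j => if j = i then Module.finrank K B else 0
  have hd : ∀ u : RepIx Q d, u.1 = i := by
    rintro ⟨j, u⟩
    by_contra hj
    have : d j = 0 := if_neg hj
    exact (Fin.cast this u).elim0
  have hcard : Fintype.card (RepIx Q d) = Module.finrank K B := by
    simp [d]
  have b : Module.Basis (RepIx Q d) K B :=
    (Module.finBasis K B).reindex (Fintype.equivFinOfCardEq hcard).symm
  have hmk : ∀ x : B, ∃ t : FreeAlgebra K (Q.V ⊕ Q.A),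
      q (φ (RingQuot.mkAlgHom K (PathRel K Q) t)) = x :=
    (hq.comp (hadm.1.comp (RingQuot.mkAlgHom_surjective K _)))
  choose t ht using fun y => hmk (b y)
  obtain ⟨M₁, hM₁, hM₁'⟩ := exists_mem_repSet_of_quotient q hi hd (Algebra.leftMulMatrix b)
  obtain ⟨M₂, hM₂, hM₂'⟩ := exists_mem_repSet_of_quotient q hi hd (rightMulMatrixTranspose b)
  obtain ⟨M, hM, hM₁, hM₂⟩ := (hirr d).2 _ _
    (isOpen_det_mulVec_ne_zero (b.repr 1) t) (isOpen_det_vecMul_ne_zero (b.repr 1) t)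
    ⟨M₁, hM₁, by
      have : (Matrix.of fun x y => (repEval M₁ (t y)).mulVec (b.repr 1) x) = 1 := by
        ext x y
        simp [← hM₁', ht, Algebra.leftMulMatrix_mulVec_repr, Matrix.one_apply,
          Finsupp.single_apply, eq_comm]
      simp [this]⟩
    ⟨M₂, hM₂, by
      have : (Matrix.of fun x y => Matrix.vecMul (b.repr 1) (repEval M₂ (t x)) y) = 1 := by
        ext x y
        simp [← hM₂', ht, vecMul_rightMulMatrixTranspose, Matrix.one_apply,
          Finsupp.single_apply]
      simp [this]⟩
  obtain ⟨ρ, hρ⟩ := exists_algHom_of_mem_repSet hadm hM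
  refine ⟨RepIx Q d, inferInstance, inferInstance, ρ, b.repr 1, b.repr 1, hcard, ?_, ?_, ?_⟩
  · intro j hj
    have : ∀ u : RepIx Q d, u.1 ≠ j := fun u h => hj (h.symm.trans (hd u))
    have h := hρ (FreeAlgebra.ι K (Sum.inl j))
    rw [vertexElem, h]
    simp [repEval, vertexBlock, this]
  · intro w
    obtain ⟨c, rfl⟩ := exists_mulVec_eq_of_det_ne_zero hM₁ w
    refine ⟨∑ y, c y • φ (RingQuot.mkAlgHom K (PathRel K Q) (t y)), ?_⟩
    simp only [map_sum, map_smul, hρ, Matrix.sum_mulVec, Matrix.smul_mulVec]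
    ext x
    simp [Matrix.mulVec, dotProduct, mul_comm]
  · intro w
    have hM₂' := hM₂
    rw [Set.mem_ofPred_eq, ← Matrix.det_transpose] at hM₂'
    obtain ⟨c, rfl⟩ := exists_mulVec_eq_of_det_ne_zero hM₂' w
    refine ⟨∑ y, c y • φ (RingQuot.mkAlgHom K (PathRel K Q) (t y)), ?_⟩
    simp only [map_sum, map_smul, hρ, Matrix.vecMul_sum, Matrix.vecMul_smul]
    ext x
    rw [Matrix.mulVec, dotProduct, Finset.sum_apply]
    simp [mul_comm]

/-! ## Algebras generated by jointly nilpotent elements -/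

section Nilpotent

variable {ι B : Type} [Ring B] [Algebra K B]

/-- The span of the products of at least `k` members of the family `x`. -/
def wordSpan (K : Type) [Field K] {ι B : Type} [Ring B] [Algebra K B] (x : ι → B) (k : ℕ) :
    Submodule K B :=
  Submodule.span K {y | ∃ l : List ι, k ≤ l.length ∧ (l.map x).prod = y}

variable {x : ι → B}

theorem mul_mem_wordSpan {j k : ℕ} {y z : B} (hy : y ∈ wordSpan K x j)
    (hz : z ∈ wordSpan K x k) : y * z ∈ wordSpan K x (j + k) := by
  have h := Submodule.mul_mem_mul hy hz
  rw [wordSpan, wordSpan, Submodule.span_mul_span] at h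
  refine Submodule.span_mono ?_ h
  rintro _ ⟨_, ⟨l, hl, rfl⟩, _, ⟨l', hl', rfl⟩, rfl⟩
  exact ⟨l ++ l', by rw [List.length_append]; omega, by simp⟩

theorem wordSpan_eq_bot {m : ℕ} (hm : ∀ l : List ι, m ≤ l.length → (l.map x).prod = 0) :
    wordSpan K x m = ⊥ := by
  rw [wordSpan, Submodule.span_eq_bot]
  rintro _ ⟨l, hl, rfl⟩
  exact hm l hl

variable {aug : B →ₐ[K] K}

theorem mem_wordSpan_one (hgen : wordSpan K x 0 = ⊤) (hx : ∀ a, aug (x a) = 0) {t : B}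
    (ht : aug t = 0) : t ∈ wordSpan K x 1 := by
  have key : ∀ b ∈ wordSpan K x 0, b - algebraMap K B (aug b) ∈ wordSpan K x 1 := by
    intro b hb
    induction hb using Submodule.span_induction with
    | mem y hy =>
      obtain ⟨l, -, rfl⟩ := hy
      cases l with
      | nil => simp
      | cons a l =>
        simp only [List.map_cons, List.prod_cons, map_mul, hx, zero_mul, map_zero, sub_zero]
        exact Submodule.subset_span ⟨a :: l, by simp, by simp⟩
    | zero => simp
    | add y z _ _ hy hz =>
      have := add_mem hy hz
      rwa [← add_sub_add_comm, ← map_add, ← map_add] at this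
    | smul c y _ hy =>
      have := Submodule.smul_mem _ c hy
      rwa [smul_sub, Algebra.smul_def c (algebraMap K B _), ← map_mul, ← smul_eq_mul,
        ← map_smul] at this
  simpa [ht] using key t (by rw [hgen]; trivial)

theorem isNilpotent_of_augmentation_eq_zero (hgen : wordSpan K x 0 = ⊤)
    (hx : ∀ a, aug (x a) = 0) {m : ℕ} (hm : ∀ l : List ι, m ≤ l.length → (l.map x).prod = 0)
    {t : B} (ht : aug t = 0) : IsNilpotent t := by
  have h : ∀ k, t ^ k ∈ wordSpan K x k := by
    intro k
    induction k with
    | zero => rw [hgen]; trivial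
    | succ k ih => rw [pow_succ]; exact mul_mem_wordSpan ih (mem_wordSpan_one hgen hx ht)
  have := h m
  rw [wordSpan_eq_bot hm] at this
  exact ⟨m, by simpa using this⟩

theorem exists_socle_element (hgen : wordSpan K x 0 = ⊤)
    (hx : ∀ a, aug (x a) = 0) {m : ℕ} (hm : ∀ l : List ι, m ≤ l.length → (l.map x).prod = 0) :
    ∃ z : B, z ≠ 0 ∧ ∀ t, t * z = aug t • z ∧ z * t = aug t • z := by
  classical
  have hex : ∃ k, wordSpan K x k = ⊥ := ⟨m, wordSpan_eq_bot hm⟩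
  have : Nontrivial B := aug.toRingHom.domain_nontrivial
  obtain ⟨k, hk⟩ : ∃ k, Nat.find hex = k + 1 := by
    refine Nat.exists_eq_succ_of_ne_zero fun h => ?_
    have := Nat.find_spec hex
    rw [h, hgen] at this
    exact top_ne_bot this
  have hbot : wordSpan K x (k + 1) = ⊥ := hk ▸ Nat.find_spec hex
  obtain ⟨z, hz, hz0⟩ := (Submodule.ne_bot_iff _).mp (Nat.find_min hex (m := k) (by omega))
  refine ⟨z, hz0, fun t => ?_⟩
  have ht : t - algebraMap K B (aug t) ∈ wordSpan K x 1 :=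
    mem_wordSpan_one hgen hx (by simp)
  have h1 := mul_mem_wordSpan ht hz
  have h2 := mul_mem_wordSpan hz ht
  rw [add_comm, hbot, Submodule.mem_bot, sub_mul, sub_eq_zero] at h1
  rw [hbot, Submodule.mem_bot, mul_sub, sub_eq_zero] at h2
  rw [h1, h2, ← Algebra.commutes, Algebra.smul_def]
  exact ⟨rfl, rfl⟩

theorem isUnit_of_augmentation_ne_zero (hnil : ∀ t, aug t = 0 → IsNilpotent t) {c : B}
    (hc : aug c ≠ 0) : IsUnit c := by
  have h := (hnil (c - algebraMap K B (aug c)) (by simp)).isUnit_add_left_of_commute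
    ((isUnit_iff_ne_zero.mpr hc).map (algebraMap K B)) (Algebra.commutes _ _).symm
  simpa using h

/-- In a local algebra `B` with a cyclic and cocyclic module of dimension `dim B` and another one
of dimension `dim B - 1`, the maximal ideal is a principal right ideal. -/
theorem exists_generator_of_cyclic_cocyclic [Module.Finite K B]
    (hnil : ∀ t, aug t = 0 → IsNilpotent t)
    {X X' : Type} [Fintype X] [DecidableEq X] [Fintype X'] [DecidableEq X']
    (hX : Fintype.card X = Module.finrank K B)
    (hX' : Fintype.card X' + 1 = Module.finrank K B)
    (ρ : B →ₐ[K] Matrix X X K) (v f : X → K)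
    (hv : ∀ w, ∃ b, (ρ b).mulVec v = w) (hf : ∀ w, ∃ b, Matrix.vecMul f (ρ b) = w)
    (ρ' : B →ₐ[K] Matrix X' X' K) (v' f' : X' → K)
    (hv' : ∀ w, ∃ b, (ρ' b).mulVec v' = w) (hf' : ∀ w, ∃ b, Matrix.vecMul f' (ρ' b) = w) :
    ∃ c, aug c = 0 ∧ ∀ t, aug t = 0 → ∃ y, t = c * y := by
  let L : B →ₗ[K] X → K := (Matrix.mulVecBilin K K).flip v ∘ₗ ρ.toLinearMap
  let R : B →ₗ[K] X → K := Matrix.vecMulBilin K K f ∘ₗ ρ.toLinearMap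
  let R' : B →ₗ[K] X' → K := Matrix.vecMulBilin K K f' ∘ₗ ρ'.toLinearMap
  have hdim : Module.finrank K B = Module.finrank K (X → K) := by simp [hX]
  have hLinj : Function.Injective L :=
    (LinearMap.injective_iff_surjective_of_finrank_eq_finrank hdim).mpr hv
  have hRinj : Function.Injective R :=
    (LinearMap.injective_iff_surjective_of_finrank_eq_finrank hdim).mpr hf
  let e : B ≃ₗ[K] (X → K) := LinearEquiv.ofBijective L ⟨hLinj, hv⟩
  let g : B →ₗ[K] K := dotProductBilin K K f' ∘ₗ (Matrix.mulVecBilin K K).flip v' ∘ₗ ρ'.toLinearMap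
  have hg : ∀ b, g b = f' ⬝ᵥ (ρ' b).mulVec v' := fun b => rfl
  obtain ⟨c, hc⟩ : ∃ c, ∀ b, g b = f ⬝ᵥ (ρ (c * b)).mulVec v := by
    obtain ⟨c, hc⟩ := hf fun x => g (e.symm (Pi.single x 1))
    refine ⟨c, fun b => ?_⟩
    rw [map_mul, ← Matrix.mulVec_mulVec, Matrix.dotProduct_mulVec, hc]
    have h1 : b = e.symm ((ρ b).mulVec v) := (e.symm_apply_apply b).symm
    have h2 : (ρ b).mulVec v = ∑ x, (ρ b).mulVec v x • Pi.single x (1 : K) := by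
      ext y; simp [Finset.sum_apply, Pi.single_apply]
    conv_lhs => rw [h1, h2]
    simp [dotProduct, mul_comm]
  have hker : LinearMap.ker (LinearMap.mulLeft K c) = LinearMap.ker R' := by
    ext b
    have hR' : R' b = Matrix.vecMul f' (ρ' b) := rfl
    rw [LinearMap.mem_ker, LinearMap.mem_ker, LinearMap.mulLeft_apply, hR']
    constructor
    · intro h
      refine dotProduct_eq_zero _ fun w => ?_
      obtain ⟨b', rfl⟩ := hv' w
      rw [← Matrix.dotProduct_mulVec, Matrix.mulVec_mulVec, ← map_mul, ← hg, hc, ← mul_assoc, h]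
      simp
    · intro h
      apply hRinj
      rw [map_zero]
      change Matrix.vecMul f (ρ (c * b)) = 0
      refine dotProduct_eq_zero _ fun w => ?_
      obtain ⟨b', rfl⟩ := hv w
      rw [← Matrix.dotProduct_mulVec, Matrix.mulVec_mulVec, ← map_mul, mul_assoc, ← hc, hg, map_mul,
        ← Matrix.mulVec_mulVec, Matrix.dotProduct_mulVec, h, zero_dotProduct]
  have hR'range : Module.finrank K (LinearMap.range R') = Fintype.card X' := by
    have : LinearMap.range R' = ⊤ := LinearMap.range_eq_top.mpr hf'
    rw [this]; simp
  have h1 := LinearMap.finrank_range_add_finrank_ker R'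
  have h2 := LinearMap.finrank_range_add_finrank_ker (LinearMap.mulLeft K c)
  have hcnu : ¬ IsUnit c := by
    intro hu
    have : LinearMap.ker (LinearMap.mulLeft K c) = ⊥ :=
      LinearMap.ker_eq_bot.mpr hu.mul_right_injective
    rw [← hker, this, finrank_bot] at h1
    omega
  have hc0 : aug c = 0 := by
    by_contra h
    exact hcnu (isUnit_of_augmentation_ne_zero hnil h)
  refine ⟨c, hc0, ?_⟩
  have haug : Function.Surjective aug.toLinearMap := fun k => ⟨algebraMap K B k, by simp⟩
  have h3 := LinearMap.finrank_range_add_finrank_ker aug.toLinearMap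
  rw [LinearMap.range_eq_top.mpr haug, finrank_top, Module.finrank_self] at h3
  have hle : LinearMap.range (LinearMap.mulLeft K c) ≤ LinearMap.ker aug.toLinearMap := by
    rintro _ ⟨b, rfl⟩
    simp [hc0]
  have heq := Submodule.eq_of_le_of_finrank_eq hle (by rw [hker] at h2; omega)
  intro t ht
  have : t ∈ LinearMap.range (LinearMap.mulLeft K c) := by rw [heq]; exact ht
  obtain ⟨y, rfl⟩ := this
  exact ⟨y, rfl⟩

end Nilpotent

/-! ## Loops -/

theorem exists_quotient_by_socle_element {B : Type} [Ring B] [Algebra K B] [Module.Finite K B]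
    {aug : B →ₐ[K] K} {z : B} (hz0 : z ≠ 0)
    (hz : ∀ t, t * z = aug t • z ∧ z * t = aug t • z) :
    ∃ (B' : Type) (_ : Ring B') (_ : Algebra K B') (q : B →ₐ[K] B'), Function.Surjective q ∧
      Module.finrank K B' + 1 = Module.finrank K B := by
  have : (Ideal.span {z}).IsTwoSided := ⟨fun {x} y hx => by
    obtain ⟨w, rfl⟩ := Ideal.mem_span_singleton'.mp hx
    refine Ideal.mem_span_singleton'.mpr ⟨aug y • w, ?_⟩
    rw [mul_assoc, (hz y).2, mul_smul_comm, smul_mul_assoc]⟩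
  let q := Ideal.Quotient.mkₐ K (Ideal.span {z})
  have hq : Function.Surjective q := Ideal.Quotient.mkₐ_surjective K _
  refine ⟨B ⧸ Ideal.span {z}, inferInstance, inferInstance, q, hq, ?_⟩
  have hker : LinearMap.ker q.toLinearMap = Submodule.span K {z} := by
    ext y
    rw [LinearMap.mem_ker, Submodule.mem_span_singleton]
    change Ideal.Quotient.mk (Ideal.span {z}) y = 0 ↔ _
    rw [Ideal.Quotient.eq_zero_iff_mem, Ideal.mem_span_singleton']
    constructor
    · rintro ⟨w, rfl⟩
      exact ⟨aug w, (hz w).1.symm⟩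
    · rintro ⟨k, rfl⟩
      exact ⟨algebraMap K B k, (Algebra.smul_def k z).symm⟩
  have h := LinearMap.finrank_range_add_finrank_ker q.toLinearMap
  have hrange : LinearMap.range q.toLinearMap = ⊤ := LinearMap.range_eq_top.mpr hq
  rwa [hker, finrank_span_singleton hz0, hrange, finrank_top] at h

/-- The largest quotient of `A` in which all vertices but `i` vanish. -/
theorem exists_quotient_at_vertex (φ : PathAlgebra K Q →ₐ[K] A) (i : Q.V) :
    ∃ (B : Type) (_ : Ring B) (_ : Algebra K B) (q : A →ₐ[K] B), Function.Surjective q ∧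
      (∀ j, j ≠ i → q (φ (vertexElem K Q j)) = 0) ∧
      ∀ (C : Type) [Ring C] [Algebra K C] (σ : A →ₐ[K] C),
        (∀ j, j ≠ i → σ (φ (vertexElem K Q j)) = 0) → ∃ τ : B →ₐ[K] C, τ.comp q = σ := by
  let r : A → A → Prop := fun x y => (∃ j, j ≠ i ∧ x = φ (vertexElem K Q j)) ∧ y = 0
  refine ⟨RingQuot r, inferInstance, inferInstance, RingQuot.mkAlgHom K r,
    RingQuot.mkAlgHom_surjective K r, ?_, ?_⟩
  · intro j hj
    have : r (φ (vertexElem K Q j)) 0 := ⟨⟨j, hj, rfl⟩, rfl⟩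
    rw [RingQuot.mkAlgHom_rel K this, map_zero]
  · intro C _ _ σ hσ
    refine ⟨RingQuot.liftAlgHom K ⟨σ, ?_⟩, ?_⟩
    · rintro _ _ ⟨⟨j, hj, rfl⟩, rfl⟩
      rw [hσ j hj, map_zero]
    · ext x
      exact RingQuot.liftAlgHom_mkAlgHom_apply K σ _ x

/-- Loops at `i` may be sent to arbitrary elements of a square-zero ideal. -/
theorem IsAdmissiblePresentation.exists_algHom_trivSqZeroExt
    (hadm : IsAdmissiblePresentation K Q φ) (i : Q.V) {W : Type} [AddCommGroup W] [Module K W]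
    [Module Kᵐᵒᵖ W] [IsCentralScalar K W] (w : Q.A → W)
    (hw : ∀ a, w a ≠ 0 → Q.tgt a = i ∧ Q.src a = i) :
    ∃ σ : A →ₐ[K] TrivSqZeroExt K W, (∀ a, σ (φ (arrowElem K Q a)) = TrivSqZeroExt.inr (w a)) ∧
      ∀ j, j ≠ i → σ (φ (vertexElem K Q j)) = 0 := by
  let g : FreeAlgebra K (Q.V ⊕ Q.A) →ₐ[K] TrivSqZeroExt K W :=
    FreeAlgebra.lift K (Sum.elim (fun j => if j = i then 1 else 0) fun a => .inr (w a))
  have hg : ∀ ⦃s t⦄, PathRel K Q s t → g s = g t := by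
    intro s t h
    induction h with
    | idem j => by_cases hj : j = i <;> simp [g, hj]
    | orth j k h =>
      by_cases hj : j = i
      · subst hj; simp [g, h.symm]
      · simp [g, hj]
    | sum_one => simp [g]
    | tgt_mul a =>
      by_cases h : w a = 0
      · simp [g, h]
      · simp [g, (hw a h).1]
    | mul_src a =>
      by_cases h : w a = 0
      · simp [g, h]
      · simp [g, (hw a h).2]
  let ψ := RingQuot.liftAlgHom K ⟨g, hg⟩
  have hψ : ∀ t, ψ (RingQuot.mkAlgHom K (PathRel K Q) t) = g t := fun t =>
    RingQuot.liftAlgHom_mkAlgHom_apply K _ _ t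
  have hψa : ∀ a, ψ (arrowElem K Q a) = TrivSqZeroExt.inr (w a) := fun a => by
    simp [arrowElem, hψ, g]
  obtain ⟨σ, hσ⟩ := hadm.exists_factor ψ fun c j k hc _ => by
    rw [map_relElem]
    refine Finset.sum_eq_zero fun p hp => ?_
    beta_reduce
    rw [List.prod_map_eq_zero_of_mul_eq_zero _ (by simp [hψa]) _ (hc p hp).1, smul_zero]
  refine ⟨σ, fun a => by rw [hσ, hψa], fun j hj => ?_⟩
  rw [hσ, vertexElem, hψ]
  simp [g, hj]

theorem prod_map_eq_zero_of_le_length {m : ℕ}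
    (hm : ∀ p : QPath Q, m ≤ p.length → φ (pathElem K Q p) = 0) (hm0 : 0 < m) (i : Q.V)
    {B : Type} [Ring B] [Algebra K B] (q : A →ₐ[K] B)
    (hi : ∀ j, j ≠ i → q (φ (vertexElem K Q j)) = 0) (l : List Q.A) (hl : m ≤ l.length) :
    (l.map fun a => q (φ (arrowElem K Q a))).prod = 0 := by
  by_cases h : ∀ a ∈ l, Q.tgt a = i ∧ Q.src a = i
  · have hne : l ≠ [] := by rintro rfl; simp at hl; omega
    have hchain : l.IsChain fun a b => Q.src a = Q.tgt b :=
      (List.pairwise_iff_forall_sublist.mpr fun {a b} hab => by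
        rw [(h a (hab.subset (by simp))).2, (h b (hab.subset (by simp))).1]).isChain
    have := congrArg q (hm ⟨l, hne, hchain⟩ hl)
    simpa [pathElem, map_list_prod, Function.comp_def] using this
  · push Not at h
    obtain ⟨a, ha, hai⟩ := h
    refine List.prod_eq_zero (List.mem_map.mpr ⟨a, ha, ?_⟩)
    by_cases ht : Q.tgt a = i
    · rw [← arrowElem_mul_src, map_mul, map_mul, hi _ (hai ht), mul_zero]
    · rw [← vertexElem_tgt_mul, map_mul, map_mul, hi _ ht, zero_mul]

theorem wordSpan_arrows_eq_top (hadm : IsAdmissiblePresentation K Q φ) (i : Q.V)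
    {B : Type} [Ring B] [Algebra K B] (q : A →ₐ[K] B) (hq : Function.Surjective q)
    (hi : ∀ j, j ≠ i → q (φ (vertexElem K Q j)) = 0) :
    wordSpan K (fun a => q (φ (arrowElem K Q a))) 0 = ⊤ := by
  set x := fun a => q (φ (arrowElem K Q a))
  have h1 : (1 : B) ∈ wordSpan K x 0 := Submodule.subset_span ⟨[], by simp, by simp⟩
  let g : FreeAlgebra K (Q.V ⊕ Q.A) →ₐ[K] B :=
    (q.comp φ).comp (RingQuot.mkAlgHom K (PathRel K Q))
  have hg : Function.Surjective g := hq.comp (hadm.1.comp (RingQuot.mkAlgHom_surjective K _))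
  have hgι : ∀ s, g (FreeAlgebra.ι K s) ∈ wordSpan K x 0 := by
    rintro (j | a)
    · change q (φ (vertexElem K Q j)) ∈ _
      by_cases hj : j = i
      · subst hj
        have := congrArg (fun x => q (φ x)) (sum_vertexElem (K := K) (Q := Q))
        simp only [map_sum, map_one] at this
        rw [Finset.sum_eq_single j (fun k _ hk => hi k hk) (by simp)] at this
        rwa [this]
      · rw [hi j hj]; exact zero_mem _
    · change x a ∈ _
      exact Submodule.subset_span ⟨[a], by simp, by simp⟩
  clear_value g
  rw [Submodule.eq_top_iff']
  intro b
  obtain ⟨t, rfl⟩ := hg b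
  induction t using FreeAlgebra.induction with
  | grade0 k =>
    rw [AlgHom.commutes, Algebra.algebraMap_eq_smul_one]
    exact Submodule.smul_mem _ _ h1
  | grade1 s => exact hgι s
  | mul s t hs ht =>
    rw [map_mul]
    exact (mul_mem_wordSpan (j := 0) (k := 0) hs ht :)
  | add s t hs ht =>
    rw [map_add]
    exact add_mem hs ht

theorem IsGeomIrreducible.loop_unique [Module.Finite K A] (hirr : IsGeomIrreducible K Q φ)
    (hadm : IsAdmissiblePresentation K Q φ) {a b : Q.A} (ha : Q.src a = Q.tgt a)
    (hb : Q.src b = Q.tgt b) (hab : Q.src a = Q.src b) : a = b := by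
  by_contra hne
  set i := Q.src a
  obtain ⟨B, _, _, q, hq, hi, hlift⟩ := exists_quotient_at_vertex φ i
  have : Module.Finite K B := Module.Finite.of_surjective q.toLinearMap hq
  obtain ⟨σ, hσ, hσi⟩ := hadm.exists_algHom_trivSqZeroExt i
    (fun c => if c = a then ((1, 0) : K × K) else if c = b then (0, 1) else 0) (by
      intro c hc
      by_cases hca : c = a
      · subst hca; exact ⟨ha.symm, rfl⟩
      · by_cases hcb : c = b
        · subst hcb; exact ⟨hb.symm.trans hab.symm, hab.symm⟩
        · simp [hca, hcb] at hc)
  obtain ⟨θ, hθ⟩ := hlift _ σ hσi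
  let aug : B →ₐ[K] K := (TrivSqZeroExt.fstHom K K (K × K)).comp θ
  have hθx : ∀ c, θ (q (φ (arrowElem K Q c))) = TrivSqZeroExt.inr _ := fun c => by
    rw [← hσ, ← hθ]; rfl
  have haugx : ∀ c, aug (q (φ (arrowElem K Q c))) = 0 := fun c => by simp [aug, hθx]
  obtain ⟨m, hm2, hm⟩ := hadm.2.2
  have hword := prod_map_eq_zero_of_le_length hm (by omega) i q hi
  have hgen := wordSpan_arrows_eq_top hadm i q hq hi
  have hnil : ∀ t, aug t = 0 → IsNilpotent t := fun t ht =>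
    isNilpotent_of_augmentation_eq_zero hgen haugx hword ht
  obtain ⟨z, hz0, hz⟩ := exists_socle_element hgen haugx hword
  obtain ⟨B', _, _, q', hq', hdim⟩ := exists_quotient_by_socle_element hz0 hz
  have : Module.Finite K B' := Module.Finite.of_surjective q'.toLinearMap hq'
  obtain ⟨X, _, _, ρ, v, f, hX, hρi, hv, hf⟩ := hirr.exists_cyclic_cocyclic hadm i q hq hi
  obtain ⟨X', _, _, ρ', v', f', hX', hρi', hv', hf'⟩ :=
    hirr.exists_cyclic_cocyclic hadm i (q'.comp q) (hq'.comp hq) fun j hj => by simp [hi j hj]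
  obtain ⟨τ, rfl⟩ := hlift _ ρ hρi
  obtain ⟨τ', rfl⟩ := hlift _ ρ' hρi'
  obtain ⟨c, hc0, hc⟩ := exists_generator_of_cyclic_cocyclic hnil hX (by rw [hX', hdim]) τ v f
    (fun w => (hv w).imp' q fun _ => id) (fun w => (hf w).imp' q fun _ => id) τ' v' f'
    (fun w => (hv' w).imp' q fun _ => id) (fun w => (hf' w).imp' q fun _ => id)
  obtain ⟨y, hy⟩ := hc _ (haugx a)
  obtain ⟨y', hy'⟩ := hc _ (haugx b)
  have hcfst : (θ c).fst = 0 := hc0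
  have h1 := congrArg (fun t => (θ t).snd) hy
  have h2 := congrArg (fun t => (θ t).snd) hy'
  simp only [hθx, map_mul, TrivSqZeroExt.snd_inr, TrivSqZeroExt.snd_mul, hcfst, zero_smul,
    zero_add, if_true, if_neg (Ne.symm hne), op_smul_eq_smul, Prod.ext_iff, Prod.smul_fst,
    Prod.smul_snd, smul_eq_mul] at h1 h2
  obtain ⟨h11, h12⟩ := h1
  obtain ⟨h21, h22⟩ := h2
  have : (1 : K) = 0 := by
    linear_combination h11 * ((θ y').fst * (θ c).snd.2) + h22 - (θ y).fst * (θ c).snd.2 * h21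
  exact one_ne_zero this

/-! ## Closed walks -/

/-- `IsWalk l u v` says that the arrows in `l` compose to a possibly empty path from `v` to `u`. -/
def IsWalk : List Q.A → Q.V → Q.V → Prop
  | [], u, v => u = v
  | a :: l, u, v => Q.tgt a = u ∧ IsWalk l (Q.src a) v

theorem isWalk_of_isChain : ∀ (l : List Q.A) (hl : l ≠ [])
    (_ : l.IsChain fun a b => Q.src a = Q.tgt b),
    IsWalk l (Q.tgt (l.head hl)) (Q.src (l.getLast hl))
  | [a], _, _ => ⟨rfl, rfl⟩
  | a :: b :: l, _, h => by
    rw [List.isChain_cons_cons] at h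
    refine ⟨rfl, ?_⟩
    rw [h.1]
    simpa using isWalk_of_isChain (b :: l) (by simp) h.2

theorem IsWalk.isChain : ∀ {l : List Q.A} {u v : Q.V}, IsWalk l u v →
    l.IsChain fun a b => Q.src a = Q.tgt b
  | [], _, _, _ => .nil
  | [_], _, _, _ => .singleton _
  | _ :: _ :: _, _, _, h => List.isChain_cons_cons.mpr ⟨h.2.1.symm, IsWalk.isChain h.2⟩

theorem IsWalk.append : ∀ {l l' : List Q.A} {u v w : Q.V}, IsWalk l u v → IsWalk l' v w →
    IsWalk (l ++ l') u w
  | [], _, _, _, _, h, h' => by cases h; exact h'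
  | _ :: _, _, _, _, _, h, h' => ⟨h.1, h.2.append h'⟩

theorem IsWalk.flatten_replicate {l : List Q.A} {u : Q.V} (h : IsWalk l u u) :
    ∀ n, IsWalk (List.replicate n l).flatten u u
  | 0 => rfl
  | n + 1 => h.append (h.flatten_replicate n)

theorem IsWalk.filter_nonloops : ∀ {l : List Q.A} {u v : Q.V}, IsWalk l u v →
    IsWalk (l.filter fun a => Q.src a ≠ Q.tgt a) u v
  | [], _, _, h => h
  | a :: l, u, v, h => by
    by_cases ha : Q.src a = Q.tgt a
    · rw [List.filter_cons_of_neg (by simp [ha])]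
      have := h.2.filter_nonloops
      rwa [ha, h.1] at this
    · rw [List.filter_cons_of_pos (by simp [ha])]
      exact ⟨h.1, h.2.filter_nonloops⟩

theorem IsWalk.prod_map_apply_ne_zero {M : RepSpace K Q fun _ => 1}
    (hM : BlockCompatible K Q _ M) : ∀ {l : List Q.A} {u v : Q.V}, IsWalk l u v →
    (∀ a ∈ l, M a ⟨Q.tgt a, 0⟩ ⟨Q.src a, 0⟩ ≠ 0) → (l.map M).prod ⟨u, 0⟩ ⟨v, 0⟩ ≠ 0
  | [], u, v, h, _ => by cases h; simp
  | a :: l, u, v, h, hl => by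
    obtain ⟨rfl, h⟩ := h
    rw [List.map_cons, List.prod_cons, Matrix.mul_apply,
      Finset.sum_eq_single ⟨Q.src a, 0⟩ _ (by simp)]
    · exact mul_ne_zero (hl a (by simp))
        (h.prod_map_apply_ne_zero hM fun b hb => hl b (by simp [hb]))
    · rintro ⟨w, k⟩ - hw
      by_contra hne
      apply hw
      have := (hM a _ _ (left_ne_zero_of_mul hne)).2
      simp only at this
      subst this
      rw [Subsingleton.elim k 0]

/-! ## Cycles consist of loops -/

theorem single_mem_repSet (φ : PathAlgebra K Q →ₐ[K] A) (a : Q.A) (ha : Q.src a ≠ Q.tgt a) :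
    (fun b => if b = a then Matrix.single ⟨Q.tgt a, 0⟩ ⟨Q.src a, 0⟩ 1 else 0) ∈
      RepSet K Q φ fun _ => 1 := by
  constructor
  · intro b u v h
    by_cases hb : b = a
    · subst hb
      simp only [if_true, Matrix.single_apply, ne_eq, ite_eq_right_iff, not_forall] at h
      obtain ⟨⟨rfl, rfl⟩, -⟩ := h
      exact ⟨rfl, rfl⟩
    · simp [hb] at h
  · intro c i j hc _
    refine Finset.sum_eq_zero fun p hp => ?_
    beta_reduce
    rw [pathProd, List.prod_map_eq_zero_of_mul_eq_zero _ _ _ (hc p hp).1, smul_zero]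
    intro b b'
    by_cases hb : b = a <;> by_cases hb' : b' = a <;> simp [hb, hb', ha]

theorem isOpen_apply_ne_zero (a : Q.A) (u v : RepIx Q d) :
    @IsOpen _ (repTopology K Q d) {M : RepSpace K Q d | M a u v ≠ 0} :=
  ⟨_, TopologicalSpace.GenerateOpen.basic _ ⟨MvPolynomial.X (a, u, v), rfl⟩, by ext M; simp⟩

theorem IsGeomIrreducible.exists_nonzero_on_nonloops (hirr : IsGeomIrreducible K Q φ)
    (s : Finset Q.A) (hs : ∀ a ∈ s, Q.src a ≠ Q.tgt a) :
    ∃ M ∈ RepSet K Q φ fun _ => 1, ∀ a ∈ s, M a ⟨Q.tgt a, 0⟩ ⟨Q.src a, 0⟩ ≠ 0 := by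
  let _ := repTopology K Q fun _ => 1
  suffices h : ∃ U : Set (RepSpace K Q fun _ => 1), IsOpen U ∧
      (RepSet K Q φ (fun _ => 1) ∩ U).Nonempty ∧
      ∀ M ∈ U, ∀ a ∈ s, M a ⟨Q.tgt a, 0⟩ ⟨Q.src a, 0⟩ ≠ 0 by
    obtain ⟨U, -, ⟨M, hM, hU⟩, h⟩ := h
    exact ⟨M, hM, h M hU⟩
  induction s using Finset.induction with
  | empty => exact ⟨Set.univ, isOpen_univ, by simpa using (hirr fun _ => 1).1, by simp⟩
  | insert a s _ ih =>
    obtain ⟨U, hU, hne, h⟩ := ih fun b hb => hs b (by simp [hb])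
    have ha := isOpen_apply_ne_zero (K := K) (d := fun _ => 1) a ⟨Q.tgt a, 0⟩ ⟨Q.src a, 0⟩
    refine ⟨_, hU.inter ha, (hirr fun _ => 1).2 _ _ hU ha hne
      ⟨_, single_mem_repSet φ a (hs a (by simp)), by simp⟩, ?_⟩
    rintro M ⟨hMU, hMa⟩ b hb
    rcases Finset.mem_insert.mp hb with rfl | hb
    · exact hMa
    · exact h M hMU b hb

theorem IsGeomIrreducible.src_eq_tgt_of_isCycle (hirr : IsGeomIrreducible K Q φ)
    (hadm : IsAdmissiblePresentation K Q φ) {p : QPath Q} (hp : p.IsCycle) :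
    ∀ a ∈ p.arrows, Q.src a = Q.tgt a := by
  intro a ha
  by_contra hne
  set l := p.arrows.filter fun a => Q.src a ≠ Q.tgt a with hl
  have hwalk : IsWalk l p.tgt p.tgt := by
    have := (isWalk_of_isChain p.arrows p.ne p.chain).filter_nonloops
    change IsWalk l p.tgt p.src at this
    rwa [hp] at this
  have hal : a ∈ l := by simp [hl, ha, hne]
  obtain ⟨M, hM, hMl⟩ := hirr.exists_nonzero_on_nonloops l.toFinset (by simp [hl])
  obtain ⟨m, hm2, hm⟩ := hadm.2.2
  set L := (List.replicate m l).flatten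
  have hLwalk : IsWalk L p.tgt p.tgt := hwalk.flatten_replicate m
  have hLlen : m ≤ L.length := by
    have := List.length_pos_of_mem hal
    simp only [L, List.length_flatten, List.map_replicate, List.sum_replicate, smul_eq_mul]
    exact Nat.le_mul_of_pos_right m this
  have hLne : L ≠ [] := by
    rintro h
    rw [h, List.length_nil] at hLlen
    omega
  obtain ⟨ρ, hρ⟩ := exists_algHom_of_mem_repSet hadm hM
  have h0 := congrArg ρ (hm ⟨L, hLne, hLwalk.isChain⟩ hLlen)
  have hρa : ∀ b, ρ (φ (arrowElem K Q b)) = M b := fun b => by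
    rw [arrowElem, hρ]; simp [repEval]
  simp only [pathElem, map_list_prod, List.map_map, Function.comp_def, hρa, map_zero] at h0
  refine hLwalk.prod_map_apply_ne_zero hM.1 (fun b hb => hMl b ?_) (by rw [h0]; rfl)
  rw [List.mem_toFinset]
  obtain ⟨l', hl', hb⟩ := List.mem_flatten.mp hb
  rwa [← List.eq_of_mem_replicate hl']

theorem src_eq_of_isChain_of_loops : ∀ {l : List Q.A} {a : Q.A},
    (a :: l).IsChain (fun a b => Q.src a = Q.tgt b) →
    (∀ b ∈ a :: l, Q.src b = Q.tgt b) → ∀ b ∈ a :: l, Q.src a = Q.src b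
  | [], a, _, _, b, hb => by simp_all
  | c :: l, a, h, hloop, b, hb => by
    rw [List.isChain_cons_cons] at h
    rcases List.mem_cons.mp hb with rfl | hb
    · rfl
    · rw [h.1, ← hloop c (by simp)]
      exact src_eq_of_isChain_of_loops h.2 (fun b hb => hloop b (List.mem_cons_of_mem _ hb)) b hb

end Representations

/-- Let `A = KQ/I` be a finite-dimensional algebra over an algebraically
closed field `K`, where `Q` is a finite quiver and `I` is an admissible ideal of `KQ`.
If `A` is geometrically irreducible, then every cycle in `Q` is a power of a loop, i.e.
for every cycle `(a₁, …, aₘ)` in `Q` there is a loop `ε` with `a₁ = ⋯ = aₘ = ε`. -/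
theorem cycle_is_power_of_loop_of_geomIrreducible [IsAlgClosed K]
    (A : Type) [Ring A] [Algebra K A] [Module.Finite K A]
    (φ : PathAlgebra K Q →ₐ[K] A) (hadm : IsAdmissiblePresentation K Q φ)
    (hirr : IsGeomIrreducible K Q φ) :
    ∀ p : QPath Q, p.IsCycle →
      ∃ e : Q.A, Q.src e = Q.tgt e ∧ ∀ a ∈ p.arrows, a = e := by
  intro p hp
  have hloop := hirr.src_eq_tgt_of_isCycle hadm hp
  obtain ⟨arrows, hne, hchain⟩ := p
  cases arrows with
  | nil => exact absurd rfl hne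
  | cons e l =>
    exact ⟨e, hloop e (by simp), fun a ha => hirr.loop_unique hadm (hloop a ha)
      (hloop e (by simp)) (src_eq_of_isChain_of_loops hchain hloop a ha).symm⟩
end
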